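/- arXiv:1202.6028 — 7 statements merged into one kernel-verified Lean document; each statement's English description precedes it below -/
import Mathlib

section
/- Let C be the set of real numbers of the form Σ_{n=1}^∞ d_n 10^{-n} with all digits d_n ∈ {0,1}, and let D be the set of numbers of the form Σ_{n=1}^∞ d_n 10^{-n} with all digits d_n ∈ {0,2}. If E ⊆ C and a ∈ ℝ satisfy E + a ⊆ D, then E contains at most one point (in particular E has Hausdorff dimension zero). -/
theorem hasSum_three_div_ten_pow : HasSum (fun n : ℕ => (3 : ℝ) / 10 ^ (n + 1)) (1 / 3) := by
  have h := (hasSum_geometric_of_lt_one (r := (1 / 10 : ℝ)) (by norm_num) (by norm_num)).mul_left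
    (3 / 10)
  have hterm : (fun n : ℕ => (3 : ℝ) / 10 ^ (n + 1)) = fun n => 3 / 10 * (1 / 10) ^ n := by
    ext n
    rw [one_div, inv_pow, pow_succ]
    field_simp
  have hvalue : (1 / 3 : ℝ) = 3 / 10 * (1 - 1 / 10)⁻¹ := by norm_num
  rwa [hterm, hvalue]

theorem norm_div_ten_pow_le {e : ℕ → ℝ} (he : ∀ n, |e n| ≤ 3) (n : ℕ) :
    ‖e n / 10 ^ (n + 1)‖ ≤ 3 / 10 ^ (n + 1) := by
  rw [Real.norm_eq_abs, abs_div, abs_of_pos (by positivity : (0 : ℝ) < 10 ^ (n + 1))]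
  gcongr
  exact he n

theorem summable_div_ten_pow {e : ℕ → ℝ} (he : ∀ n, |e n| ≤ 3) :
    Summable fun n : ℕ => e n / 10 ^ (n + 1) :=
  hasSum_three_div_ten_pow.summable.of_norm_bounded (norm_div_ten_pow_le he)

/-- If a decimal expansion of zero has digits in `{0} ∪ {d | 1 ≤ |d| ≤ 3}`, then its first digit
vanishes and the shifted expansion also represents zero. -/
theorem head_eq_zero_and_tail_eq_zero {e : ℕ → ℝ} (he : ∀ n, |e n| ≤ 3)
    (hgap : ∀ n, e n = 0 ∨ 1 ≤ |e n|) (hsum : ∑' n : ℕ, e n / 10 ^ (n + 1) = 0) :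
    e 0 = 0 ∧ ∑' n : ℕ, e (n + 1) / 10 ^ (n + 1) = 0 := by
  have hshift : ∑' n : ℕ, e n / 10 ^ (n + 1) =
      e 0 / 10 + (∑' n : ℕ, e (n + 1) / 10 ^ (n + 1)) / 10 := by
    rw [(summable_div_ten_pow he).tsum_eq_zero_add, ← tsum_div_const]
    simp only [zero_add, pow_one, div_div, ← pow_succ]
  have htail : |∑' n : ℕ, e (n + 1) / 10 ^ (n + 1)| ≤ 1 / 3 :=
    tsum_of_norm_bounded hasSum_three_div_ten_pow
      (norm_div_ten_pow_le (e := fun n => e (n + 1)) fun n => he (n + 1))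
  have hhead : e 0 = 0 := by
    refine (hgap 0).resolve_right fun h => ?_
    have : e 0 = -∑' n : ℕ, e (n + 1) / 10 ^ (n + 1) := by linarith
    rw [this, abs_neg] at h
    linarith
  exact ⟨hhead, by linarith⟩

/-- A decimal expansion of zero with digits in `{0} ∪ {d | 1 ≤ |d| ≤ 3}` is trivial. -/
theorem eq_zero_of_tsum_div_ten_pow_eq_zero (n : ℕ) {e : ℕ → ℝ} (he : ∀ n, |e n| ≤ 3)
    (hgap : ∀ n, e n = 0 ∨ 1 ≤ |e n|) (hsum : ∑' n : ℕ, e n / 10 ^ (n + 1) = 0) : e n = 0 := by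
  obtain ⟨hhead, htail⟩ := head_eq_zero_and_tail_eq_zero he hgap hsum
  induction n generalizing e with
  | zero => exact hhead
  | succ n ih =>
    have h := head_eq_zero_and_tail_eq_zero (e := fun n => e (n + 1))
      (fun n => he (n + 1)) (fun n => hgap (n + 1)) htail
    exact ih (e := fun n => e (n + 1)) (fun n => he (n + 1)) (fun n => hgap (n + 1)) htail h.1 h.2


/-- Let `C` be the set of reals `Σ_{n≥1} d_n 10^{-n}` with digits in `{0,1}`
and `D` the analogous set with digits in `{0,2}`. If `E ⊆ C` and `a ∈ ℝ` satisfy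
`E + a ⊆ D`, then `E` has at most one point. -/
theorem statement5
    (C D E : Set ℝ) (a : ℝ)
    (hC : C = {x : ℝ | ∃ dig : ℕ → ℝ, (∀ n, dig n = 0 ∨ dig n = 1) ∧
      x = ∑' n : ℕ, dig n / 10 ^ (n + 1)})
    (hD : D = {x : ℝ | ∃ dig : ℕ → ℝ, (∀ n, dig n = 0 ∨ dig n = 2) ∧
      x = ∑' n : ℕ, dig n / 10 ^ (n + 1)})
    (hE : E ⊆ C) (hEa : ∀ x ∈ E, x + a ∈ D) :
    E.Subsingleton := by
  intro x hx y hy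
  have hxC := hE hx
  have hyC := hE hy
  have hxD := hEa x hx
  have hyD := hEa y hy
  rw [hC] at hxC hyC
  rw [hD] at hxD hyD
  obtain ⟨c, hc, hxc⟩ := hxC
  obtain ⟨c', hc', hyc⟩ := hyC
  obtain ⟨d, hd, hxd⟩ := hxD
  obtain ⟨d', hd', hyd⟩ := hyD
  have sc : Summable fun n : ℕ => c n / 10 ^ (n + 1) :=
    summable_div_ten_pow fun n => by rcases hc n with h | h <;> norm_num [h]
  have sc' : Summable fun n : ℕ => c' n / 10 ^ (n + 1) :=
    summable_div_ten_pow fun n => by rcases hc' n with h | h <;> norm_num [h]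
  have sd : Summable fun n : ℕ => d n / 10 ^ (n + 1) :=
    summable_div_ten_pow fun n => by rcases hd n with h | h <;> norm_num [h]
  have sd' : Summable fun n : ℕ => d' n / 10 ^ (n + 1) :=
    summable_div_ten_pow fun n => by rcases hd' n with h | h <;> norm_num [h]
  have hsum : ∑' n : ℕ, ((c n - c' n) - (d n - d' n)) / 10 ^ (n + 1) = 0 := by
    simp only [sub_div]
    rw [(sc.sub sc').tsum_sub (sd.sub sd'), sc.tsum_sub sc', sd.tsum_sub sd']
    linarith
  have hdigit (n : ℕ) : (c n - c' n) - (d n - d' n) = 0 := by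
    refine eq_zero_of_tsum_div_ten_pow_eq_zero n (e := fun n => (c n - c' n) - (d n - d' n))
      (fun n => ?_) (fun n => ?_) hsum <;>
    rcases hc n with h₁ | h₁ <;> rcases hc' n with h₂ | h₂ <;> rcases hd n with h₃ | h₃ <;>
      rcases hd' n with h₄ | h₄ <;> norm_num [h₁, h₂, h₃, h₄]
  have hcc : c = c' := by
    ext n
    have h := hdigit n
    rcases hc n with h₁ | h₁ <;> rcases hc' n with h₂ | h₂ <;> rcases hd n with h₃ | h₃ <;>
      rcases hd' n with h₄ | h₄ <;> linarith
  rw [hxc, hyc, hcc]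
end

section
/- Let τ_1, …, τ_N : ℝ^d → ℝ^d be contracting similitudes with common ratio 0 < λ < 1, i.e. τ_i(x) = λ·U(x) + c_i for a linear isometry U of ℝ^d and c_i ∈ ℝ^d. Let X be the nonempty compact attractor, satisfying X = ⋃_{i=1}^N τ_i(X), and let μ be a Borel probability measure supported on X satisfying μ(E) = Σ_{i=1}^N p_i μ(τ_i^{-1}(E)) for all Borel sets E, where p_i > 0 and Σ p_i = 1. If the open set condition holds — there exists a nonempty open set U ⊆ ℝ^d with ⋃_{i=1}^N τ_i(U) ⊆ U and τ_i(U) ∩ τ_j(U) = ∅ for i ≠ j — then the system has no overlap: μ(τ_i(X) ∩ τ_j(X)) = 0 for all i ≠ j. -/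
open MeasureTheory
open scoped ENNReal

/-! Composition along a word `w` of an IFS `τ` is written `w.foldr τ`. -/

section Words

variable {ι E : Type*}

theorem foldr_mapsTo {τ : ι → E → E} {V : Set E} (hV : ∀ i, ∀ x ∈ V, τ i x ∈ V) (w : List ι)
    {x : E} (hx : x ∈ V) : w.foldr τ x ∈ V := by
  induction w with
  | nil => exact hx
  | cons i w ih => exact hV i _ ih

theorem foldr_injective {τ : ι → E → E} (hτ : ∀ i, Function.Injective (τ i)) (w : List ι) :
    Function.Injective fun x => w.foldr τ x := by
  induction w with
  | nil => exact fun _ _ h => h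
  | cons i w ih => exact (hτ i).comp ih

/-- Under the open set condition, words of equal length with intersecting images of `V` agree. -/
theorem eq_of_foldr_eq_foldr {τ : ι → E → E} (hτ : ∀ i, Function.Injective (τ i)) {V : Set E}
    (hV : ∀ i, ∀ x ∈ V, τ i x ∈ V)
    (hdisj : ∀ i j, i ≠ j → Disjoint (τ i '' V) (τ j '' V)) {w v : List ι}
    (hlen : v.length = w.length) {x y : E} (hx : x ∈ V) (hy : y ∈ V)
    (h : v.foldr τ x = w.foldr τ y) : v = w := by
  induction w generalizing v with
  | nil => exact List.length_eq_zero_iff.1 hlen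
  | cons j w ih =>
    obtain _ | ⟨i, v⟩ := v
    · simp at hlen
    · simp only [List.foldr_cons] at h
      have hij : i = j := by
        by_contra hij
        exact Set.disjoint_left.1 (hdisj i j hij) ⟨_, foldr_mapsTo hV v hx, rfl⟩
          ⟨_, foldr_mapsTo hV w hy, h.symm⟩
      subst hij
      rw [ih (by simpa using hlen) (hτ i h)]

/-- Every point of the attractor lies in the image of the attractor under a word of any length. -/
theorem exists_foldr_eq {τ : ι → E → E} {X : Set E} (hX : X = ⋃ i, τ i '' X) (n : ℕ) {x : E}
    (hx : x ∈ X) : ∃ w : List ι, w.length = n ∧ ∃ y ∈ X, w.foldr τ y = x := by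
  induction n generalizing x with
  | zero => exact ⟨[], rfl, x, hx, rfl⟩
  | succ n ih =>
    rw [hX] at hx
    obtain ⟨i, y, hy, rfl⟩ := Set.mem_iUnion.1 hx
    obtain ⟨w, hw, z, hz, rfl⟩ := ih hy
    exact ⟨i :: w, by simp [hw], z, hz, rfl⟩

/-- A bounded function on words that is harmonic for the weights `q` and vanishes on all words
ending in `u` vanishes on nonempty words. -/
theorem eq_zero_of_harmonic [Fintype ι] {q : ι → ℝ} (hq : ∀ i, 0 < q i) (hsum : ∑ i, q i = 1)
    {f : List ι → ℝ} (hf0 : ∀ w, 0 ≤ f w) (hf1 : ∀ w, f w ≤ 1)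
    (hf : ∀ w, f w = ∑ i, q i * f (w ++ [i])) {u : List ι}
    (hu : ∀ w, w ≠ [] → f (w ++ u) = 0) (w : List ι) (hw : w ≠ []) : f w = 0 := by
  classical
  have hbound (C : ℝ) (hC : ∀ w, w ≠ [] → f w ≤ C) (u : List ι) (w : List ι) (hw : w ≠ []) :
      f w ≤ (1 - (u.map q).prod) * C + (u.map q).prod * f (w ++ u) := by
    induction u generalizing w with
    | nil => simp
    | cons a u ih =>
      have h1 : f w ≤ (1 - q a) * C + q a * f (w ++ [a]) := by
        rw [hf w, ← Finset.add_sum_erase _ _ (Finset.mem_univ a), add_comm, ← hsum,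
          ← Finset.add_sum_erase _ q (Finset.mem_univ a), add_sub_cancel_left, Finset.sum_mul]
        gcongr with i hi
        · exact (hq i).le
        · exact hC _ (by simp)
      have h2 := mul_le_mul_of_nonneg_left (ih (w ++ [a]) (by simp)) (hq a).le
      simp only [List.append_assoc, List.singleton_append] at h2
      simp only [List.map_cons, List.prod_cons]
      linarith
  have hprod : 0 < (u.map q).prod := List.prod_pos (by simpa using fun i _ => hq i)
  have hprod1 : (u.map q).prod ≤ 1 := by
    clear hu hprod
    induction u with
    | nil => simp
    | cons i u ih =>
      rw [List.map_cons, List.prod_cons]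
      have hi : q i ≤ 1 :=
        hsum ▸ Finset.single_le_sum (fun j _ => (hq j).le) (Finset.mem_univ i)
      exact (mul_le_of_le_one_right (hq i).le ih).trans hi
  have hpow (k : ℕ) : ∀ w, w ≠ [] → f w ≤ (1 - (u.map q).prod) ^ k := by
    induction k with
    | zero => simpa using fun w _ => hf1 w
    | succ k ih =>
      intro w hw
      have := hbound _ ih u w hw
      rw [hu w hw] at this
      rw [pow_succ]
      linarith
  refine le_antisymm ?_ (hf0 w)
  exact ge_of_tendsto' (tendsto_pow_atTop_nhds_zero_of_lt_one (by linarith) (by linarith))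
    fun k => hpow k w hw

end Words

section Neighbors

variable {ι E : Type*} [NormedAddCommGroup E]

/-- Words `v` as long as `w` whose map is that of `w` precomposed with a translation of norm at
most `R`. -/
def wordNeighbors (τ : ι → E → E) (R : ℝ) (w : List ι) : Set (List ι) :=
  {v | v.length = w.length ∧ ∃ z : E, ‖z‖ ≤ R ∧ ∀ x, v.foldr τ x = w.foldr τ (x + z)}

theorem append_mem_wordNeighbors {τ : ι → E → E} {R : ℝ} {u v : List ι}
    (hv : v ∈ wordNeighbors τ R u) (w : List ι) : w ++ v ∈ wordNeighbors τ R (w ++ u) := by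
  obtain ⟨hlen, z, hz, h⟩ := hv
  exact ⟨by simp [hlen], z, hz, fun x => by simp [List.foldr_append, h]⟩

theorem exists_ncard_wordNeighbors_le [ProperSpace E] {τ : ι → E → E}
    (hτ : ∀ i, Function.Injective (τ i)) {V : Set E} (hVne : V.Nonempty) (hVopen : IsOpen V)
    (hV : ∀ i, ∀ x ∈ V, τ i x ∈ V)
    (hdisj : ∀ i j, i ≠ j → Disjoint (τ i '' V) (τ j '' V)) (R : ℝ) :
    ∃ K : ℕ, ∀ w, (wordNeighbors τ R w).Finite ∧ (wordNeighbors τ R w).ncard ≤ K := by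
  obtain ⟨a, ha⟩ := hVne
  obtain ⟨r, hr, hball⟩ := Metric.isOpen_iff.1 hVopen a ha
  obtain ⟨t, -, ht, hcov⟩ :=
    (isCompact_closedBall (0 : E) R).finite_cover_balls (half_pos hr)
  refine ⟨t.ncard, fun w => ?_⟩
  have hchoice (v : List ι) (hv : v ∈ wordNeighbors τ R w) :
      ∃ y ∈ t, ∃ z ∈ Metric.ball y (r / 2), ∀ x, v.foldr τ x = w.foldr τ (x + z) := by
    obtain ⟨-, z, hz, h⟩ := hv
    obtain ⟨y, hy, hzy⟩ := Set.mem_iUnion₂.1 (hcov (mem_closedBall_zero_iff.2 hz))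
    exact ⟨y, hy, z, hzy, h⟩
  choose! g hgt z hz h using hchoice
  have hinj : Set.InjOn g (wordNeighbors τ R w) := by
    intro v hv v' hv' hvv
    refine eq_of_foldr_eq_foldr (V := V) hτ hV hdisj (hv.1.trans hv'.1.symm) ha
      (y := a + (z v - z v')) (hball ?_) ?_
    · rw [Metric.mem_ball, dist_self_add_left, ← dist_eq_norm]
      have h1 := Metric.mem_ball.1 (hz v hv)
      have h2 := Metric.mem_ball.1 (hz v' hv')
      rw [← hvv] at h2
      linarith [dist_triangle_right (z v) (z v') (g v)]
    · rw [h v hv, h v' hv']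
      congr 1
      abel
  exact ⟨Set.Finite.of_injOn hgt hinj ht, Set.ncard_le_ncard_of_injOn g hgt hinj ht⟩

/-- Some word `u` has a maximal number of neighbors, so that prefixing it with `w` creates no
neighbors other than those prefixed by `w`. -/
theorem exists_wordNeighbors_append_subset {τ : ι → E → E} {R : ℝ} {K : ℕ}
    (hK : ∀ w, (wordNeighbors τ R w).Finite ∧ (wordNeighbors τ R w).ncard ≤ K) :
    ∃ u, ∀ w, wordNeighbors τ R (w ++ u) ⊆ (w ++ ·) '' wordNeighbors τ R u := by
  let u := Function.argmin fun w : List ι => K - (wordNeighbors τ R w).ncard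
  refine ⟨u, fun w => ?_⟩
  have hsub : (w ++ ·) '' wordNeighbors τ R u ⊆ wordNeighbors τ R (w ++ u) :=
    Set.image_subset_iff.2 fun v hv => append_mem_wordNeighbors hv w
  refine (Set.eq_of_subset_of_ncard_le hsub ?_ (hK _).1).ge
  rw [Set.ncard_image_of_injective _ (List.append_right_injective w)]
  have hmin : K - (wordNeighbors τ R u).ncard ≤ K - (wordNeighbors τ R (w ++ u)).ncard :=
    Function.argmin_le (fun w : List ι => K - (wordNeighbors τ R w).ncard) _
  have := (hK u).2
  have := (hK (w ++ u)).2
  omega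

variable {A : E ≃+ E} {c : ι → E} {τ : ι → E → E}

theorem exists_foldr_add_eq (hτ : ∀ i x, τ i x = A x + c i) (w : List ι) (e : E) :
    ∃ z, ∀ x, w.foldr τ x + e = w.foldr τ (x + z) := by
  induction w generalizing e with
  | nil => exact ⟨e, fun _ => rfl⟩
  | cons i w ih =>
    obtain ⟨z, hz⟩ := ih (A.symm e)
    refine ⟨z, fun x => ?_⟩
    simp only [List.foldr_cons, ← hz, hτ, map_add, AddEquiv.apply_symm_apply]
    abel

theorem exists_translation (hτ : ∀ i x, τ i x = A x + c i) {v w : List ι}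
    (hlen : v.length = w.length) : ∃ z, ∀ x, v.foldr τ x = w.foldr τ (x + z) := by
  induction w generalizing v with
  | nil => exact ⟨0, fun x => by simp [List.length_eq_zero_iff.1 hlen]⟩
  | cons j w ih =>
    obtain _ | ⟨i, v⟩ := v
    · simp at hlen
    · obtain ⟨z, hz⟩ := ih (v := v) (by simpa using hlen)
      obtain ⟨z', hz'⟩ := exists_foldr_add_eq hτ w (A.symm (c i - c j))
      refine ⟨z + z', fun x => ?_⟩
      simp only [List.foldr_cons, hz, ← add_assoc, ← hz', hτ, map_add,
        AddEquiv.apply_symm_apply]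
      abel

/-- The open set condition yields a word `u` such that the piece of the attractor of any word
`i :: w ++ u` misses all other first-level pieces. -/
theorem exists_word_forall_foldr_notMem [ProperSpace E] (hτ : ∀ i x, τ i x = A x + c i)
    {X : Set E} (hXb : Bornology.IsBounded X) (hX : X = ⋃ i, τ i '' X)
    {V : Set E} (hVne : V.Nonempty) (hVopen : IsOpen V) (hV : ∀ i, ∀ x ∈ V, τ i x ∈ V)
    (hdisj : ∀ i j, i ≠ j → Disjoint (τ i '' V) (τ j '' V)) :
    ∃ u : List ι, ∀ i w j, i ≠ j → ∀ x ∈ X, (i :: w ++ u).foldr τ x ∉ τ j '' X := by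
  have hinj (i : ι) : Function.Injective (τ i) := fun x y h => by simpa [hτ] using h
  obtain ⟨R, hR⟩ := Metric.isBounded_iff.1 hXb
  obtain ⟨K, hK⟩ := exists_ncard_wordNeighbors_le hinj hVne hVopen hV hdisj R
  obtain ⟨u, hu⟩ := exists_wordNeighbors_append_subset hK
  refine ⟨u, fun i w j hij x hx ⟨y, hy, hxy⟩ => ?_⟩
  obtain ⟨s, hs, y, hyX, rfl⟩ := exists_foldr_eq hX (w ++ u).length hy
  have hlen : (j :: s).length = (i :: w ++ u).length := by simp [hs]
  obtain ⟨z, hz⟩ := exists_translation hτ hlen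
  have hzx : y + z = x := foldr_injective hinj (i :: w ++ u) ((hz y).symm.trans hxy)
  have hzR : ‖z‖ ≤ R := by
    have := hR hx hyX
    rwa [← hzx, dist_self_add_left] at this
  obtain ⟨v, -, hv⟩ := hu (i :: w) ⟨hlen, z, hzR, hz⟩
  simp only [List.cons_append, List.cons.injEq] at hv
  exact hij hv.1

end Neighbors

/-- For a self-similar IFS of contracting similitudes of common ratio
`0 < λ < 1` with attractor `X` and invariant probability measure `μ` (weights `p_i > 0`
summing to `1`), the open set condition implies no overlap:
`μ(τ_i(X) ∩ τ_j(X)) = 0` for `i ≠ j`. -/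
theorem statement7 {d N : ℕ} (hN : 0 < N) (lam : ℝ) (hlam0 : 0 < lam) (hlam1 : lam < 1)
    (U : EuclideanSpace ℝ (Fin d) →ₗᵢ[ℝ] EuclideanSpace ℝ (Fin d))
    (c : Fin N → EuclideanSpace ℝ (Fin d))
    (τ : Fin N → EuclideanSpace ℝ (Fin d) → EuclideanSpace ℝ (Fin d))
    (hτ : ∀ i x, τ i x = lam • U x + c i)
    (X : Set (EuclideanSpace ℝ (Fin d))) (hXne : X.Nonempty) (hXcomp : IsCompact X)
    (hX : X = ⋃ i, τ i '' X)
    (p : Fin N → ℝ≥0∞) (hp : ∀ i, 0 < p i) (hpsum : ∑ i, p i = 1)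
    (μ : Measure (EuclideanSpace ℝ (Fin d))) [IsProbabilityMeasure μ]
    (hμX : μ Xᶜ = 0)
    (hinv : ∀ E : Set (EuclideanSpace ℝ (Fin d)), MeasurableSet E →
      μ E = ∑ i, p i * μ (τ i ⁻¹' E))
    (V : Set (EuclideanSpace ℝ (Fin d))) (hVne : V.Nonempty) (hVopen : IsOpen V)
    (hVsub : ⋃ i, τ i '' V ⊆ V)
    (hVdisj : ∀ i j, i ≠ j → Disjoint (τ i '' V) (τ j '' V)) :
    ∀ i j, i ≠ j → μ (τ i '' X ∩ τ j '' X) = 0 := by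
  intro i j hij
  let A : EuclideanSpace ℝ (Fin d) ≃ₗ[ℝ] EuclideanSpace ℝ (Fin d) :=
    (U.toLinearIsometryEquiv rfl).toLinearEquiv.trans
      (LinearEquiv.smulOfNeZero ℝ _ lam hlam0.ne')
  have hA (k) (x) : τ k x = A.toAddEquiv x + c k := hτ k x
  have hcont (k) : Continuous (τ k) := by
    have : τ k = fun x => lam • U x + c k := funext (hτ k)
    rw [this]
    fun_prop
  have hcontw (w : List (Fin N)) : Continuous fun x => w.foldr τ x := by
    induction w with
    | nil => exact continuous_id
    | cons k w ih => exact (hcont k).comp ih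
  obtain ⟨u, hu⟩ := exists_word_forall_foldr_notMem hA hXcomp.isBounded hX hVne hVopen
    (fun k x hx => hVsub (Set.mem_iUnion.2 ⟨k, x, hx, rfl⟩)) hVdisj
  have hmeas : MeasurableSet (τ i '' X ∩ τ j '' X) :=
    ((hXcomp.image (hcont i)).inter (hXcomp.image (hcont j))).measurableSet
  have hptop (k) : p k ≠ ∞ :=
    ne_top_of_le_ne_top ENNReal.one_ne_top
      (hpsum ▸ Finset.single_le_sum (fun _ _ => zero_le) (Finset.mem_univ k))
  let f (w : List (Fin N)) : ℝ := μ.real ((fun x => w.foldr τ x) ⁻¹' (τ i '' X ∩ τ j '' X))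
  have hf (w) : f w = ∑ k, (p k).toReal * f (w ++ [k]) := by
    simp only [f, Measure.real]
    rw [hinv _ ((hcontw w).measurable hmeas), ENNReal.toReal_sum fun k _ =>
      ENNReal.mul_ne_top (hptop k) (measure_ne_top _ _)]
    simp [ENNReal.toReal_mul, Set.preimage_preimage, List.foldr_append]
  have hfu (w) (hw : w ≠ []) : f (w ++ u) = 0 := by
    obtain ⟨k, w, rfl⟩ := List.exists_cons_of_ne_nil hw
    refine (measureReal_eq_zero_iff (measure_ne_top _ _)).2
      (measure_mono_null (t := Xᶜ) (fun x hx hxX => ?_) hμX)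
    by_cases hki : k = i
    · exact hu k w j (hki ▸ hij) x hxX hx.2
    · exact hu k w i hki x hxX hx.1
  have hzero := eq_zero_of_harmonic (fun k => ENNReal.toReal_pos (hp k).ne' (hptop k))
    (by rw [← ENNReal.toReal_sum fun k _ => hptop k, hpsum, ENNReal.toReal_one])
    (fun _ => measureReal_nonneg) (fun _ => measureReal_le_one) hf hfu
  have hnil : f [] = 0 := by
    rw [hf]
    exact Finset.sum_eq_zero fun k _ => mul_eq_zero_of_right _ (hzero _ (by simp))
  exact (measureReal_eq_zero_iff (measure_ne_top _ _)).1 hnil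
end

section
/- Let R be an invertible real d×d matrix, B = {b_1, …, b_N} ⊆ ℝ^d, τ_b(x) = R^{-1}(x + b), X a nonempty compact set with X = ⋃_{b∈B} τ_b(X), and μ a Borel probability measure supported on X with μ(E) = Σ_{b∈B} p_b μ(τ_b^{-1}(E)) for all Borel E, where p_b > 0 and Σ p_b = 1, and assume no overlap: μ(τ_b(X) ∩ τ_{b'}(X)) = 0 for b ≠ b'. Fix b ≠ c in B and n ∈ ℕ, set b^{(n)} = b + Rb + ⋯ + R^{n-1}b, c^{(n)} = c + Rc + ⋯ + R^{n-1}c, a = R^{-n}(c^{(n)} − b^{(n)}), and F = τ_b^n(X) (the n-fold iterate of τ_b applied to X). Then for every Borel set E, μ((E + a) ∩ (F + a)) = (p_c^n / p_b^n) · μ(E ∩ F); in particular the measure E ↦ μ((E + a) ∩ (F + a)) is supported on F, is absolutely continuous with respect to μ, and its Radon–Nikodym derivative equals p_c^n/p_b^n on F. -/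
open MeasureTheory
open scoped ENNReal

/-- Without overlap, each branch `τ i` of the system scales the invariant measure by `p i` on
measurable subsets of the attractor. -/
theorem measure_image_eq_of_noOverlap {α ι : Type*} [MeasurableSpace α] [Fintype ι]
    {τ : ι → α → α} (hτ : ∀ i, MeasurableEmbedding (τ i)) {X : Set α} (hXm : MeasurableSet X)
    {p : ι → ℝ≥0∞} {μ : Measure α} (hμX : μ Xᶜ = 0)
    (hinv : ∀ E : Set α, MeasurableSet E → μ E = ∑ i, p i * μ (τ i ⁻¹' E))
    (hnooverlap : ∀ i j, i ≠ j → μ (τ i '' X ∩ τ j '' X) = 0)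
    (i : ι) {E : Set α} (hE : MeasurableSet E) (hEX : E ⊆ X) :
    μ (τ i '' E) = p i * μ E := by
  rw [hinv _ ((hτ i).measurableSet_image.2 hE), Finset.sum_eq_single i]
  · rw [(hτ i).injective.preimage_image]
  · intro k _ hki
    have hoverlap : p k * μ (τ k ⁻¹' (τ i '' X ∩ τ k '' X)) = 0 := by
      have hsum := hinv _ (((hτ i).measurableSet_image.2 hXm).inter
        ((hτ k).measurableSet_image.2 hXm))
      rw [hnooverlap i k hki.symm] at hsum
      exact Finset.sum_eq_zero_iff.1 hsum.symm k (Finset.mem_univ k)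
    rcases mul_eq_zero.1 hoverlap with h | h
    · rw [h, zero_mul]
    · have hsub : τ k ⁻¹' (τ i '' E) ⊆ τ k ⁻¹' (τ i '' X ∩ τ k '' X) ∪ Xᶜ := by
        intro x hx
        by_cases hxX : x ∈ X
        · exact Or.inl ⟨Set.image_mono hEX hx, x, hxX, rfl⟩
        · exact Or.inr hxX
      rw [measure_mono_null hsub (measure_union_null h hμX), mul_zero]
  · simp

theorem measure_iterate_image_eq_of_noOverlap {α ι : Type*} [MeasurableSpace α] [Fintype ι]
    {τ : ι → α → α} (hτ : ∀ i, MeasurableEmbedding (τ i)) {X : Set α} (hXm : MeasurableSet X)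
    (hX : ∀ i, τ i '' X ⊆ X) {p : ι → ℝ≥0∞} {μ : Measure α} (hμX : μ Xᶜ = 0)
    (hinv : ∀ E : Set α, MeasurableSet E → μ E = ∑ i, p i * μ (τ i ⁻¹' E))
    (hnooverlap : ∀ i j, i ≠ j → μ (τ i '' X ∩ τ j '' X) = 0)
    (i : ι) (n : ℕ) {E : Set α} (hE : MeasurableSet E) (hEX : E ⊆ X) :
    μ ((τ i)^[n] '' E) = p i ^ n * μ E := by
  induction n generalizing E with
  | zero => simp
  | succ n ih =>
    rw [Function.iterate_succ, Set.image_comp,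
      ih ((hτ i).measurableSet_image.2 hE) ((Set.image_mono hEX).trans (hX i)),
      measure_image_eq_of_noOverlap hτ hXm hμX hinv hnooverlap i hE hEX, pow_succ, mul_assoc]

theorem toEuclideanLin_pow_iterate {d : ℕ} {R : Matrix (Fin d) (Fin d) ℝ} (hR : IsUnit R.det)
    {f : EuclideanSpace ℝ (Fin d) → EuclideanSpace ℝ (Fin d)} {v : EuclideanSpace ℝ (Fin d)}
    (hf : ∀ x, f x = Matrix.toEuclideanLin R⁻¹ (x + v)) (n : ℕ) (x : EuclideanSpace ℝ (Fin d)) :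
    Matrix.toEuclideanLin (R ^ n) (f^[n] x)
      = x + ∑ k ∈ Finset.range n, Matrix.toEuclideanLin (R ^ k) v := by
  induction n with
  | zero => simp
  | succ n ih =>
    have hmul : ∀ y, Matrix.toEuclideanLin (R ^ (n + 1)) (Matrix.toEuclideanLin R⁻¹ y)
        = Matrix.toEuclideanLin (R ^ n) y := by
      intro y
      simp [Matrix.toLpLin_apply, Matrix.mulVec_mulVec, pow_succ,
        Matrix.mul_nonsing_inv R hR]
    rw [Function.iterate_succ_apply', hf, hmul, map_add, ih, Finset.sum_range_succ, add_assoc]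

theorem measurableEmbedding_toEuclideanLin_inv_add {d : ℕ} {R : Matrix (Fin d) (Fin d) ℝ}
    (hR : IsUnit R.det) (v : EuclideanSpace ℝ (Fin d)) :
    MeasurableEmbedding fun x => Matrix.toEuclideanLin R⁻¹ (x + v) := by
  have hcont : Continuous fun x => Matrix.toEuclideanLin R⁻¹ (x + v) :=
    (LinearMap.continuous_of_finiteDimensional _).comp (continuous_id.add continuous_const)
  refine hcont.measurableEmbedding fun x y hxy => ?_
  have h := congrArg (Matrix.toEuclideanLin R) hxy
  simpa [Matrix.toLpLin_apply, Matrix.mulVec_mulVec, Matrix.mul_nonsing_inv R hR] using h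

/-- For an affine IFS `τ_b(x) = R⁻¹(x + b)` with no overlap, invariant
probability measure `μ`, distinct digits `b = b_i`, `c = b_j`, and
`a = R⁻ⁿ(c⁽ⁿ⁾ − b⁽ⁿ⁾)`, `F = τ_b^n(X)`, one has
`μ((E + a) ∩ (F + a)) = (p_c^n / p_b^n) μ(E ∩ F)` for every Borel `E`; in particular the
measure `E ↦ μ((E + a) ∩ (F + a))` is absolutely continuous with respect to `μ` with
Radon–Nikodym derivative `p_c^n/p_b^n` on `F`. Here `E + a = {x : x - a ∈ E}`. -/
theorem statement9 {d N : ℕ} (hN : 0 < N)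
    (R : Matrix (Fin d) (Fin d) ℝ) (hR : IsUnit R.det)
    (b : Fin N → EuclideanSpace ℝ (Fin d)) (hb : Function.Injective b)
    (τ : Fin N → EuclideanSpace ℝ (Fin d) → EuclideanSpace ℝ (Fin d))
    (hτ : ∀ i x, τ i x = Matrix.toEuclideanLin R⁻¹ (x + b i))
    (X : Set (EuclideanSpace ℝ (Fin d))) (hXne : X.Nonempty) (hXcomp : IsCompact X)
    (hX : X = ⋃ i, τ i '' X)
    (p : Fin N → ℝ≥0∞) (hp : ∀ i, 0 < p i) (hpsum : ∑ i, p i = 1)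
    (μ : Measure (EuclideanSpace ℝ (Fin d))) [IsProbabilityMeasure μ]
    (hμX : μ Xᶜ = 0)
    (hinv : ∀ E : Set (EuclideanSpace ℝ (Fin d)), MeasurableSet E →
      μ E = ∑ i, p i * μ (τ i ⁻¹' E))
    (hnooverlap : ∀ i j, i ≠ j → μ (τ i '' X ∩ τ j '' X) = 0)
    (i j : Fin N) (hij : i ≠ j) (n : ℕ) (hn : 0 < n)
    (bn cn a : EuclideanSpace ℝ (Fin d))
    (hbn : bn = ∑ k ∈ Finset.range n, Matrix.toEuclideanLin (R ^ k) (b i))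
    (hcn : cn = ∑ k ∈ Finset.range n, Matrix.toEuclideanLin (R ^ k) (b j))
    (ha : a = Matrix.toEuclideanLin (R⁻¹ ^ n) (cn - bn))
    (F : Set (EuclideanSpace ℝ (Fin d))) (hF : F = (τ i)^[n] '' X) :
    (∀ E : Set (EuclideanSpace ℝ (Fin d)), MeasurableSet E →
        μ ((fun x => x - a) ⁻¹' E ∩ (fun x => x - a) ⁻¹' F) = (p j ^ n / p i ^ n) * μ (E ∩ F))
      ∧ Measure.map (fun x => x - a) (μ.restrict ((fun x => x - a) ⁻¹' F)) ≪ μ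
      ∧ (Measure.map (fun x => x - a) (μ.restrict ((fun x => x - a) ⁻¹' F))).rnDeriv μ
          =ᵐ[μ.restrict F] fun _ => p j ^ n / p i ^ n := by
  have hemb : ∀ k, MeasurableEmbedding (τ k) := fun k => by
    rw [show τ k = _ from funext (hτ k)]
    exact measurableEmbedding_toEuclideanLin_inv_add hR (b k)
  have hXm := hXcomp.measurableSet
  have hsub : ∀ k, τ k '' X ⊆ X := fun k => by
    conv_rhs => rw [hX]
    exact Set.subset_iUnion (fun k => τ k '' X) k
  have hscale := fun (k : Fin N) {E : Set (EuclideanSpace ℝ (Fin d))} (hE : MeasurableSet E)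
      (hEX : E ⊆ X) =>
    measure_iterate_image_eq_of_noOverlap hemb hXm hsub hμX hinv hnooverlap k n hE hEX
  have hmeas : Measurable (τ i)^[n] := (hemb i).measurable.iterate n
  have htrans : ∀ x, (τ j)^[n] x = (τ i)^[n] x + a := by
    intro x
    have hunit : IsUnit (R ^ n).det := by rw [Matrix.det_pow]; exact hR.pow n
    have hleft : ∀ y, Matrix.toEuclideanLin (R⁻¹ ^ n) (Matrix.toEuclideanLin (R ^ n) y) = y := by
      intro y
      rw [Matrix.inv_pow']
      simp only [Matrix.toLpLin_apply, Matrix.mulVec_mulVec, Matrix.nonsing_inv_mul _ hunit,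
        Matrix.one_mulVec]
    rw [← hleft ((τ j)^[n] x), ← hleft ((τ i)^[n] x), toEuclideanLin_pow_iterate hR (hτ j),
      toEuclideanLin_pow_iterate hR (hτ i), ← hbn, ← hcn, ha, ← map_add]
    congr 1
    abel
  have hFm : MeasurableSet F := by
    rw [hF]
    exact (hmeas.measurableEmbedding ((hemb i).injective.iterate n)).measurableSet_image.2 hXm
  have hpi0 : p i ^ n ≠ 0 := pow_ne_zero _ (hp i).ne'
  have hpitop : p i ^ n ≠ ∞ := by
    refine ENNReal.pow_ne_top (ne_top_of_le_ne_top ENNReal.one_ne_top ?_)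
    rw [← hpsum]
    exact Finset.single_le_sum (fun _ _ => zero_le) (Finset.mem_univ i)
  have hmain : ∀ E : Set (EuclideanSpace ℝ (Fin d)), MeasurableSet E →
      μ ((fun x => x - a) ⁻¹' E ∩ (fun x => x - a) ⁻¹' F)
        = (p j ^ n / p i ^ n) * μ (E ∩ F) := by
    intro E hE
    have hG : MeasurableSet (X ∩ (τ i)^[n] ⁻¹' E) := hXm.inter (hmeas hE)
    have hEF : E ∩ F = (τ i)^[n] '' (X ∩ (τ i)^[n] ⁻¹' E) := by
      rw [Set.image_inter_preimage, hF, Set.inter_comm]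
    have hshift : (fun x => x - a) ⁻¹' E ∩ (fun x => x - a) ⁻¹' F
        = (τ j)^[n] '' (X ∩ (τ i)^[n] ⁻¹' E) := by
      rw [← Set.preimage_inter, hEF]
      ext y
      simp only [Set.mem_preimage, Set.mem_image, htrans, eq_sub_iff_add_eq]
    rw [hshift, hEF, hscale j hG Set.inter_subset_left, hscale i hG Set.inter_subset_left,
      ← mul_assoc, ENNReal.div_mul_cancel hpi0 hpitop]
  have hdens : Measure.map (fun x => x - a) (μ.restrict ((fun x => x - a) ⁻¹' F))
      = μ.withDensity (F.indicator fun _ => p j ^ n / p i ^ n) := by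
    ext E hE
    have hsubm : Measurable fun x : EuclideanSpace ℝ (Fin d) => x - a := measurable_sub_const a
    rw [Measure.map_apply hsubm hE, Measure.restrict_apply (hsubm hE), hmain E hE,
      withDensity_apply _ hE, setLIntegral_indicator hFm, setLIntegral_const, Set.inter_comm]
  refine ⟨hmain, hdens ▸ withDensity_absolutelyContinuous _ _, ?_⟩
  rw [hdens]
  filter_upwards [ae_restrict_of_ae (Measure.rnDeriv_withDensity μ
    (measurable_const.indicator hFm)), ae_restrict_mem hFm] with x hx hxF
  rw [hx, Set.indicator_of_mem hxF]
end

section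
/- Let τ_1, …, τ_N : ℝ^d → ℝ^d be contracting similitudes with common ratio 0 < λ < 1 (τ_i(x) = λ·U(x) + c_i with U a linear isometry), let X be the attractor (the nonempty compact set with X = ⋃ τ_i(X)) with 0 < H^α(X) < ∞ for some α > 0, and let μ be the invariant probability measure for weights p_i > 0, Σ p_i = 1 (so μ(E) = Σ p_i μ(τ_i^{-1}(E)) for all Borel E). If μ is absolutely continuous with respect to H^α restricted to X, then for every Borel set F ⊆ X and every a ∈ ℝ^d, the measure E ↦ μ((E + a) ∩ (F + a)) is absolutely continuous with respect to μ. -/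
open MeasureTheory
open scoped ENNReal

open Set Filter Topology Metric Measure

section Density

variable {Y : Type*} [MetricSpace Y] [MeasurableSpace Y] [BorelSpace Y]

/-- Vitali covering of a `ρ`-null set by few enlarged balls, when the small balls centred at
points of the set have `ρ`-measure at least `K * r ^ α`. -/
lemma exists_countable_ball_cover_of_frequently_lt_measure {ρ : Measure Y} [IsFiniteMeasure ρ]
    {K : ℝ≥0∞} {α : ℝ} {s : Set Y} (hρ : ρ s = 0)
    (hs : ∀ x ∈ s, ∃ᶠ r in 𝓝[>] (0 : ℝ), K * ENNReal.ofReal r ^ α < ρ (closedBall x r))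
    {ε : ℝ≥0∞} (hε : 0 < ε) {δ : ℝ} (hδ : 0 < δ) :
    ∃ u : Set (Y × ℝ), u.Countable ∧ s ⊆ ⋃ b : u, closedBall b.1.1 (4 * b.1.2) ∧
      (∀ b ∈ u, 0 < b.2 ∧ b.2 ≤ δ) ∧ ∑' b : u, K * ENNReal.ofReal b.1.2 ^ α ≤ ε := by
  obtain ⟨V, hsV, hVo, hVε⟩ := s.exists_isOpen_lt_of_lt (μ := ρ) ε (hρ ▸ hε)
  let t : Set (Y × ℝ) := {b | (0 < b.2 ∧ b.2 ≤ δ) ∧ closedBall b.1 b.2 ⊆ V ∧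
    K * ENNReal.ofReal b.2 ^ α < ρ (closedBall b.1 b.2)}
  obtain ⟨u, hut, hdisj, hcov⟩ := Vitali.exists_disjoint_subfamily_covering_enlargement_closedBall
    t Prod.fst Prod.snd δ (fun a ha => ha.1.2) 4 (by norm_num)
  have hdisj' : Pairwise (Function.onFun Disjoint fun b : u => closedBall b.1.1 b.1.2) :=
    fun a b hab => hdisj a.2 b.2 (Subtype.coe_injective.ne hab)
  refine ⟨u, ?_, fun x hx => ?_, fun b hb => (hut hb).1, ?_⟩
  · have h := countable_meas_pos_of_disjoint_iUnion (μ := ρ)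
      (fun b : u => (isClosed_closedBall (x := b.1.1) (ε := b.1.2)).measurableSet) hdisj'
    rw [eq_univ_of_forall (s := {b : u | 0 < ρ (closedBall b.1.1 b.1.2)})
      fun b => (zero_le).trans_lt (hut b.2).2.2] at h
    exact countable_coe_iff.1 (countable_univ_iff.1 h)
  · have hV : ∀ᶠ r in 𝓝[>] (0 : ℝ), closedBall x r ⊆ V :=
      (eventually_closedBall_subset (hVo.mem_nhds (hsV hx))).filter_mono nhdsWithin_le_nhds
    have hδ' : ∀ᶠ r in 𝓝[>] (0 : ℝ), 0 < r ∧ r ≤ δ := Ioc_mem_nhdsGT hδ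
    obtain ⟨r, hr, hrV, hr0⟩ := ((hs x hx).and_eventually (hV.and hδ')).exists
    obtain ⟨b, hb, hsub⟩ := hcov (x, r) ⟨hr0, hrV, hr⟩
    exact mem_iUnion.2 ⟨⟨b, hb⟩, hsub (mem_closedBall_self hr0.1.le)⟩
  · calc ∑' b : u, K * ENNReal.ofReal b.1.2 ^ α
        ≤ ∑' b : u, ρ (closedBall b.1.1 b.1.2) :=
          ENNReal.tsum_le_tsum fun b => (hut b.2).2.2.le
      _ ≤ ρ (⋃ b : u, closedBall b.1.1 b.1.2) :=
          tsum_meas_le_meas_iUnion_of_disjoint ρ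
            (fun b => isClosed_closedBall.measurableSet) hdisj'
      _ ≤ ρ V := measure_mono (iUnion_subset fun b => (hut b.2).2.1)
      _ ≤ ε := hVε.le

/-- A `ρ`-null set on which `ρ` has positive upper `α`-density, bounded below by a constant, is
null for the `α`-dimensional Hausdorff measure. -/
lemma hausdorffMeasure_eq_zero_of_frequently_lt_measure {ρ : Measure Y} [IsFiniteMeasure ρ]
    {K : ℝ≥0∞} (hK : K ≠ 0) (hK' : K ≠ ∞) {α : ℝ} (hα : 0 ≤ α) {s : Set Y} (hρ : ρ s = 0)
    (hs : ∀ x ∈ s, ∃ᶠ r in 𝓝[>] (0 : ℝ), K * ENNReal.ofReal r ^ α < ρ (closedBall x r)) :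
    μH[α] s = 0 := by
  have hpos (n : ℕ) : (0 : ℝ) < 1 / ((n : ℝ) + 1) := by positivity
  choose u hcount hcov hrad hsum using fun n : ℕ =>
    exists_countable_ball_cover_of_frequently_lt_measure hρ hs
      (ENNReal.ofReal_pos.2 (hpos n)) (hpos n)
  have (n : ℕ) : Countable (u n) := (hcount n).to_subtype
  have hlim : Tendsto (fun n : ℕ => ENNReal.ofReal (1 / ((n : ℝ) + 1))) atTop (𝓝 0) := by
    simpa using ENNReal.tendsto_ofReal tendsto_one_div_add_atTop_nhds_zero_nat
  have hdiam (n : ℕ) (b : u n) :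
      ediam (closedBall b.1.1 (4 * b.1.2)) ≤ 8 * ENNReal.ofReal b.1.2 := by
    have h0 := (hrad n b.1 b.2).1
    refine ediam_le fun x hx y hy => ?_
    rw [edist_dist, ← ENNReal.ofReal_ofNat 8, ← ENNReal.ofReal_mul (by norm_num)]
    refine ENNReal.ofReal_le_ofReal ((dist_triangle_right x y b.1.1).trans ?_)
    rw [mem_closedBall] at hx hy
    linarith
  have hC : (8 : ℝ≥0∞) ^ α * K⁻¹ ≠ ∞ :=
    ENNReal.mul_ne_top (ENNReal.rpow_ne_top_of_nonneg hα (by simp)) (ENNReal.inv_ne_top.2 hK)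
  have hle (n : ℕ) : ∑' b : u n, ediam (closedBall b.1.1 (4 * b.1.2)) ^ α ≤
      8 ^ α * K⁻¹ * ENNReal.ofReal (1 / ((n : ℝ) + 1)) := by
    calc ∑' b : u n, ediam (closedBall b.1.1 (4 * b.1.2)) ^ α
        ≤ ∑' b : u n, 8 ^ α * K⁻¹ * (K * ENNReal.ofReal b.1.2 ^ α) := by
          refine ENNReal.tsum_le_tsum fun b => ?_
          rw [mul_assoc, ← mul_assoc K⁻¹, ENNReal.inv_mul_cancel hK hK', one_mul,
            ← ENNReal.mul_rpow_of_nonneg _ _ hα]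
          exact ENNReal.rpow_le_rpow (hdiam n b) hα
      _ ≤ _ := by
          rw [ENNReal.tsum_mul_left]
          gcongr
          exact hsum n
  have hzero := ENNReal.Tendsto.const_mul hlim (Or.inr hC)
  rw [mul_zero] at hzero
  refine nonpos_iff_eq_zero.1 ((hausdorffMeasure_le_liminf_tsum α s
    (fun n : ℕ => 8 * ENNReal.ofReal (1 / ((n : ℝ) + 1))) ?_
    (fun n (b : u n) => closedBall b.1.1 (4 * b.1.2))
    (Eventually.of_forall fun n b => (hdiam n b).trans ?_)
    (Eventually.of_forall hcov)).trans
    (tendsto_of_tendsto_of_tendsto_of_le_of_le tendsto_const_nhds hzero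
      (fun _ => zero_le) hle).liminf_eq.le)
  · simpa using ENNReal.Tendsto.const_mul hlim (Or.inr (ENNReal.ofNat_ne_top (n := 8)))
  · gcongr
    exact (hrad n b.1 b.2).2

/-- If `X` has finite Hausdorff measure and `A` is not null, then at some point of `A` the upper
density of `X \ A` is at most a given positive constant. -/
lemma exists_eventually_hausdorffMeasure_diff_inter_closedBall_le {α : ℝ} (hα : 0 ≤ α)
    {X A : Set Y} (hA : MeasurableSet A) (hX : μH[α] X ≠ ∞) (hpos : μH[α] A ≠ 0)
    {K : ℝ≥0∞} (hK : K ≠ 0) (hK' : K ≠ ∞) :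
    ∃ x ∈ A, ∀ᶠ r in 𝓝[>] (0 : ℝ),
      μH[α] (closedBall x r ∩ (X \ A)) ≤ K * ENNReal.ofReal r ^ α := by
  by_contra! H
  have : IsFiniteMeasure ((μH[α] : Measure Y).restrict (X \ A)) :=
    isFiniteMeasure_restrict.2 (measure_ne_top_of_subset sdiff_subset hX)
  refine hpos (hausdorffMeasure_eq_zero_of_frequently_lt_measure
    (ρ := (μH[α] : Measure Y).restrict (X \ A)) hK hK' hα ?_ fun x hx => ?_)
  · rw [Measure.restrict_apply hA, inter_sdiff_self, measure_empty]
  · simpa only [Measure.restrict_apply isClosed_closedBall.measurableSet, not_le] using H x hx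

end Density

section SelfSimilar

variable {Y ι : Type*} [MetricSpace Y] [MeasurableSpace Y]

/-- Compositions of `n` maps of a system with attractor `X`: every point of `X` lies in the image
of `X` under such a composition. -/
lemma exists_iterate_through_point {τ : ι → Y → Y} {K : NNReal} {X : Set Y} {μ : Measure Y}
    (hlip : ∀ i, LipschitzWith K (τ i)) (hanti : ∀ i, AntilipschitzWith K⁻¹ (τ i))
    (hX : X = ⋃ i, τ i '' X) (hτ : ∀ i, QuasiMeasurePreserving (τ i) μ μ)
    (n : ℕ) {x : Y} (hx : x ∈ X) :
    ∃ g : Y → Y, LipschitzWith (K ^ n) g ∧ AntilipschitzWith ((K ^ n)⁻¹) g ∧ MapsTo g X X ∧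
      x ∈ g '' X ∧ QuasiMeasurePreserving g μ μ := by
  induction n generalizing x with
  | zero =>
    exact ⟨id, by simpa using LipschitzWith.id, by simpa using AntilipschitzWith.id,
      mapsTo_id _, ⟨x, hx, rfl⟩, .id μ⟩
  | succ n ih =>
    rw [hX] at hx
    obtain ⟨i, y, hy, rfl⟩ := mem_iUnion.1 hx
    obtain ⟨g, hg, hg', hgX, ⟨z, hz, rfl⟩, hgμ⟩ := ih hy
    refine ⟨τ i ∘ g, ?_, ?_, fun w hw => ?_, ⟨z, hz, rfl⟩, (hτ i).comp hgμ⟩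
    · rw [pow_succ']
      exact (hlip i).comp hg
    · rw [pow_succ', mul_inv, mul_comm]
      exact (hanti i).comp hg'
    · rw [hX]
      exact mem_iUnion.2 ⟨i, mem_image_of_mem _ (hgX hw)⟩

variable [BorelSpace Y]

/-- A null set of a measure on a self-similar set which is absolutely continuous with respect to
Hausdorff measure, and quasi-preserved by the maps of the system, is null for the Hausdorff
measure. -/
lemma hausdorffMeasure_eq_zero_of_absolutelyContinuous {τ : ι → Y → Y} {K : NNReal}
    (hK0 : 0 < K) (hK1 : K < 1) {X : Set Y} {μ : Measure Y} [NeZero μ]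
    (hlip : ∀ i, LipschitzWith K (τ i)) (hanti : ∀ i, AntilipschitzWith K⁻¹ (τ i))
    (hX : X = ⋃ i, τ i '' X) (hXb : Bornology.IsBounded X)
    (hτ : ∀ i, QuasiMeasurePreserving (τ i) μ μ)
    {α : ℝ} (hα : 0 ≤ α) (hXfin : μH[α] X ≠ ∞)
    (hac : μ ≪ (μH[α] : Measure Y).restrict X)
    {A : Set Y} (hA : MeasurableSet A) (hAX : A ⊆ X) (hμA : μ A = 0) : μH[α] A = 0 := by
  by_contra hpos
  obtain ⟨R, hR0, hR⟩ : ∃ R > 0, ∀ x ∈ X, ∀ y ∈ X, dist x y ≤ R :=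
    ⟨diam X + 1, by positivity, fun x hx y hy =>
      (dist_le_diam_of_mem hXb hx hy).trans (by linarith)⟩
  have key (m : ℕ) : ∃ g : Y → Y, QuasiMeasurePreserving g μ μ ∧
      μH[α] (X \ g ⁻¹' A) ≤ ENNReal.ofReal (1 / ((m : ℝ) + 1)) * ENNReal.ofReal R ^ α := by
    have hm : (0 : ℝ) < 1 / ((m : ℝ) + 1) := by positivity
    obtain ⟨x, hxA, hx⟩ := exists_eventually_hausdorffMeasure_diff_inter_closedBall_le hα hA hXfin
      hpos (ENNReal.ofReal_pos.2 hm).ne' ENNReal.ofReal_ne_top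
    have hlim : Tendsto (fun n : ℕ => (K : ℝ) ^ n * R) atTop (𝓝[>] 0) := by
      refine tendsto_nhdsWithin_iff.2 ⟨?_, Eventually.of_forall fun n => ?_⟩
      · simpa using (tendsto_pow_atTop_nhds_zero_of_lt_one K.2 (by exact_mod_cast hK1)).mul_const R
      · exact mul_pos (pow_pos (by exact_mod_cast hK0) n) hR0
    obtain ⟨n, hn⟩ := (hlim.eventually hx).exists
    obtain ⟨g, hg, hg', hgX, ⟨y, hy, hyx⟩, hgμ⟩ :=
      exists_iterate_through_point hlip hanti hX hτ n (hAX hxA)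
    refine ⟨g, hgμ, ?_⟩
    have himage : g '' (X \ g ⁻¹' A) ⊆ closedBall x (K ^ n * R) ∩ (X \ A) := by
      rintro _ ⟨z, ⟨hzX, hzA⟩, rfl⟩
      refine ⟨?_, hgX hzX, hzA⟩
      rw [mem_closedBall, ← hyx]
      refine (hg.dist_le_mul z y).trans ?_
      push_cast
      gcongr
      exact hR z hzX y hy
    have hKn : K ^ n ≠ 0 := (pow_pos hK0 n).ne'
    calc μH[α] (X \ g ⁻¹' A)
        ≤ ((K ^ n)⁻¹ : NNReal) ^ α * μH[α] (g '' (X \ g ⁻¹' A)) :=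
          hg'.le_hausdorffMeasure_image hα _
      _ ≤ ((K ^ n)⁻¹ : NNReal) ^ α *
          (ENNReal.ofReal (1 / ((m : ℝ) + 1)) * ENNReal.ofReal (K ^ n * R) ^ α) := by
          gcongr
          exact (measure_mono himage).trans hn
      _ = _ := by
          have h : ENNReal.ofReal ((K : ℝ) ^ n * R) = (K ^ n : NNReal) * ENNReal.ofReal R := by
            rw [ENNReal.ofReal_mul (by positivity), ← NNReal.coe_pow, ENNReal.ofReal_coe_nnreal]
          rw [h, mul_left_comm, ← ENNReal.mul_rpow_of_nonneg _ _ hα, ← mul_assoc,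
            ← ENNReal.coe_mul, inv_mul_cancel₀ hKn, ENNReal.coe_one, one_mul]
  choose g hgμ hg using key
  set B : Set Y := ⋃ m, g m ⁻¹' A
  have hB : MeasurableSet B := .iUnion fun m => (hgμ m).measurable hA
  have hBμ : μ B = 0 := measure_iUnion_null fun m => (hgμ m).preimage_null hμA
  have hlim : Tendsto (fun m : ℕ => ENNReal.ofReal (1 / ((m : ℝ) + 1)) * ENNReal.ofReal R ^ α)
      atTop (𝓝 0) := by
    have h : Tendsto (fun n : ℕ => ENNReal.ofReal (1 / ((n : ℝ) + 1))) atTop (𝓝 0) := by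
      simpa using ENNReal.tendsto_ofReal tendsto_one_div_add_atTop_nhds_zero_nat
    simpa using ENNReal.Tendsto.mul_const h
      (Or.inr (ENNReal.rpow_ne_top_of_nonneg hα (ENNReal.ofReal_ne_top (r := R))))
  have hXB : μH[α] (X \ B) = 0 := nonpos_iff_eq_zero.1 <| ge_of_tendsto' hlim fun m =>
    (measure_mono (sdiff_subset_sdiff_right (subset_iUnion (fun m => g m ⁻¹' A) m))).trans (hg m)
  have hBc : μ Bᶜ = 0 := hac (by
    rw [Measure.restrict_apply hB.compl, inter_comm]
    exact hXB)
  refine NeZero.ne μ (measure_univ_eq_zero.1 ?_)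
  rw [← union_compl_self B]
  exact measure_union_null hBμ hBc

end SelfSimilar

/-- Let `τ_i` be contracting similitudes of common ratio `λ` with attractor
`X`, `0 < H^α(X) < ∞`, and let `μ` be the invariant probability measure. If `μ ≪ H^α|_X`,
then for every Borel `F ⊆ X` and every `a ∈ ℝ^d` the measure `E ↦ μ((E + a) ∩ (F + a))`
is absolutely continuous with respect to `μ`. -/
theorem statement10 {d N : ℕ} (hN : 0 < N) (lam : ℝ) (hlam0 : 0 < lam) (hlam1 : lam < 1)
    (U : EuclideanSpace ℝ (Fin d) →ₗᵢ[ℝ] EuclideanSpace ℝ (Fin d))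
    (c : Fin N → EuclideanSpace ℝ (Fin d))
    (τ : Fin N → EuclideanSpace ℝ (Fin d) → EuclideanSpace ℝ (Fin d))
    (hτ : ∀ i x, τ i x = lam • U x + c i)
    (X : Set (EuclideanSpace ℝ (Fin d))) (hXne : X.Nonempty) (hXcomp : IsCompact X)
    (hX : X = ⋃ i, τ i '' X)
    (α : ℝ) (hα : 0 < α) (hXpos : 0 < μH[α] X) (hXfin : μH[α] X < ∞)
    (p : Fin N → ℝ≥0∞) (hp : ∀ i, 0 < p i) (hpsum : ∑ i, p i = 1)
    (μ : Measure (EuclideanSpace ℝ (Fin d))) [IsProbabilityMeasure μ]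
    (hμX : μ Xᶜ = 0)
    (hinv : ∀ E : Set (EuclideanSpace ℝ (Fin d)), MeasurableSet E →
      μ E = ∑ i, p i * μ (τ i ⁻¹' E))
    (hac : μ ≪ (μH[α] : Measure (EuclideanSpace ℝ (Fin d))).restrict X) :
    ∀ (F : Set (EuclideanSpace ℝ (Fin d))), MeasurableSet F → F ⊆ X →
      ∀ a : EuclideanSpace ℝ (Fin d),
        Measure.map (fun x => x - a) (μ.restrict ((fun x => x - a) ⁻¹' F)) ≪ μ := by
  intro F hF hFX a
  have hdist (i) (x y) : dist (τ i x) (τ i y) = lam * dist x y := by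
    rw [hτ, hτ, dist_add_right, dist_smul₀, U.dist_map, Real.norm_of_nonneg hlam0.le]
  lift lam to NNReal using hlam0.le
  have hlam0' : 0 < lam := by exact_mod_cast hlam0
  have hlip (i) : LipschitzWith lam (τ i) := .of_dist_le_mul fun x y => (hdist i x y).le
  have hanti (i) : AntilipschitzWith lam⁻¹ (τ i) := .of_le_mul_dist fun x y => by
    rw [hdist, NNReal.coe_inv, inv_mul_cancel_left₀ hlam0.ne']
  have hquasi (i) : QuasiMeasurePreserving (τ i) μ μ := by
    refine ⟨(hlip i).continuous.measurable, AbsolutelyContinuous.mk fun E hE hE0 => ?_⟩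
    rw [map_apply (hlip i).continuous.measurable hE]
    rw [hinv E hE, Finset.sum_eq_zero_iff] at hE0
    exact (mul_eq_zero.1 (hE0 i (Finset.mem_univ i))).resolve_left (hp i).ne'
  have hmeas : Measurable fun x : EuclideanSpace ℝ (Fin d) => x - a := measurable_sub_const a
  refine AbsolutelyContinuous.mk fun E hE hE0 => ?_
  rw [map_apply hmeas hE, Measure.restrict_apply (hmeas hE), ← preimage_inter]
  have hEF : μH[α] (E ∩ F) = 0 :=
    hausdorffMeasure_eq_zero_of_absolutelyContinuous hlam0' (by exact_mod_cast hlam1) hlip hanti hX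
      hXcomp.isBounded hquasi hα.le hXfin.ne hac (hE.inter hF)
      (inter_subset_right.trans hFX) (measure_mono_null inter_subset_left hE0)
  refine hac (nonpos_iff_eq_zero.1 ((restrict_apply_le _ _).trans (le_of_eq ?_)))
  exact ((IsometryEquiv.subRight a).hausdorffMeasure_preimage α (E ∩ F)).trans hEF
end

section
/- Let τ_i(x) = R^{-1}(x + b_i), i = 1, …, N, with R an invertible real d×d matrix satisfying ‖R^{-1}x‖ ≤ r‖x‖ for some 0 < r < 1, let X be the attractor (nonempty compact, X = ⋃ τ_i(X)), and μ the invariant probability measure for weights p_i > 0, Σ p_i = 1. For a word I = i_1⋯i_k ∈ {1,…,N}^k write τ_I = τ_{i_1} ∘ ⋯ ∘ τ_{i_k} and p_I = p_{i_1}⋯p_{i_k}, and for an affine map σ of the form σ = τ_I with I ∈ {1,…,N}^k set p_σ = Σ {p_J : J ∈ {1,…,N}^k, τ_J = σ}. Suppose the fixed point condition holds for σ at level k: the unique fixed point x_σ of σ satisfies x_σ ∉ τ_J(X) for every word J ∈ {1,…,N}^k with τ_J ≠ σ. Then there exist n_0 ∈ ℕ and a constant C ≥ 0, independent of n, such that μ(σ^n(X))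 = C · p_σ^n for all n ≥ n_0, where σ^n is the n-fold iterate of σ. -/
open MeasureTheory
open scoped ENNReal Classical

/-- Composition `τ_{i_1} ∘ ⋯ ∘ τ_{i_k}` for a word `I = (i_1, …, i_k)`. -/
def wordComp {α : Type*} {N k : ℕ} (τ : Fin N → α → α) (I : Fin k → Fin N) : α → α :=
  (List.ofFn I).foldr (fun i f => τ i ∘ f) id

/-- The combined weight `p_σ = Σ {p_J : J ∈ {1,…,N}^k, τ_J = σ}`. -/
noncomputable def combinedWeight {α : Type*} {N : ℕ} (τ : Fin N → α → α) (p : Fin N → ℝ≥0∞)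
    (k : ℕ) (σ : α → α) : ℝ≥0∞ :=
  ∑ J : Fin k → Fin N, if wordComp τ J = σ then ∏ j, p (J j) else 0

theorem wordComp_cons {α : Type*} {N k : ℕ} (τ : Fin N → α → α) (i : Fin N)
    (J : Fin k → Fin N) :
    wordComp τ (Fin.cons i J : Fin (k + 1) → Fin N) = τ i ∘ wordComp τ J := by
  simp [wordComp, List.ofFn_succ]

theorem wordComp_injective {α : Type*} {N k : ℕ} {τ : Fin N → α → α}
    (hτ : ∀ i, Function.Injective (τ i)) (J : Fin k → Fin N) :
    Function.Injective (wordComp τ J) := by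
  induction k with
  | zero => simpa [wordComp] using Function.injective_id
  | succ k ih =>
    rw [← Fin.cons_self_tail J, wordComp_cons]
    exact (hτ _).comp (ih _)

theorem wordComp_lipschitzWith {α : Type*} [PseudoEMetricSpace α] {N k : ℕ} {τ : Fin N → α → α}
    {K : NNReal} (hτ : ∀ i, LipschitzWith K (τ i)) (J : Fin k → Fin N) :
    LipschitzWith (K ^ k) (wordComp τ J) := by
  induction k with
  | zero => simpa [wordComp] using LipschitzWith.id
  | succ k ih =>
    rw [← Fin.cons_self_tail J, wordComp_cons, pow_succ']
    exact (hτ _).comp (ih _)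

/-- Invariance of a measure under an iterated function system, iterated `k` times. -/
theorem measure_eq_sum_wordComp {α : Type*} [MeasurableSpace α] {N : ℕ} {τ : Fin N → α → α}
    (hτ : ∀ i, Measurable (τ i)) {p : Fin N → ℝ≥0∞} {μ : Measure α}
    (hinv : ∀ E : Set α, MeasurableSet E → μ E = ∑ i, p i * μ (τ i ⁻¹' E))
    (k : ℕ) {E : Set α} (hE : MeasurableSet E) :
    μ E = ∑ J : Fin k → Fin N, (∏ j, p (J j)) * μ (wordComp τ J ⁻¹' E) := by
  induction k generalizing E with
  | zero => simp [wordComp]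
  | succ k ih =>
    rw [hinv E hE, ← (Fin.consEquiv fun _ => Fin N).sum_comp, Fintype.sum_prod_type]
    refine Finset.sum_congr rfl fun i _ => ?_
    rw [ih (hτ i hE), Finset.mul_sum]
    refine Finset.sum_congr rfl fun J _ => ?_
    have hcons : wordComp τ (Fin.consEquiv (fun _ => Fin N) (i, J)) = τ i ∘ wordComp τ J :=
      wordComp_cons τ i J
    rw [hcons, Set.preimage_comp, Fin.prod_univ_succ]
    simp only [Fin.consEquiv_apply, Fin.cons_zero, Fin.cons_succ, mul_assoc]

/-- The iterates of a contraction shrink a bounded set to the fixed point, so they eventually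
avoid any closed set that does not contain it. -/
theorem eventually_disjoint_iterate_image {α : Type*} [PseudoMetricSpace α] {f : α → α}
    {K : NNReal} (hK : K < 1) (hf : LipschitzWith K f) {x : α} (hx : f x = x)
    {X F : Set α} (hX : Bornology.IsBounded X) (hF : IsClosed F) (hxF : x ∉ F) :
    ∀ᶠ n in Filter.atTop, Disjoint (f^[n] '' X) F := by
  obtain ⟨ε, hε, hball⟩ := Metric.isOpen_iff.1 hF.isOpen_compl x hxF
  obtain ⟨M, hM⟩ := hX.subset_closedBall x
  have hlim : Filter.Tendsto (fun n => (K : ℝ) ^ n * M) Filter.atTop (nhds 0) := by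
    simpa using (tendsto_pow_atTop_nhds_zero_of_lt_one K.2 (by exact_mod_cast hK)).mul_const M
  filter_upwards [hlim.eventually_lt_const hε] with n hn
  rw [Set.disjoint_left]
  rintro _ ⟨y, hy, rfl⟩
  refine hball ?_
  rw [Metric.mem_ball]
  calc dist (f^[n] y) x = dist (f^[n] y) (f^[n] x) := by rw [Function.iterate_fixed hx]
    _ ≤ (K : ℝ) ^ n * dist y x := by simpa using (hf.iterate n).dist_le_mul y x
    _ ≤ (K : ℝ) ^ n * M := by gcongr; exact hM hy
    _ < ε := hn

theorem combinedWeight_ne_top {α : Type*} {N : ℕ} (τ : Fin N → α → α) {p : Fin N → ℝ≥0∞}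
    (hp : ∀ i, p i ≠ ∞) (k : ℕ) (σ : α → α) : combinedWeight τ p k σ ≠ ∞ := by
  refine ENNReal.sum_ne_top.2 fun J _ => ?_
  split_ifs
  · exact ENNReal.prod_ne_top fun j _ => hp _
  · simp

theorem combinedWeight_wordComp_ne_zero {α : Type*} {N : ℕ} (τ : Fin N → α → α)
    {p : Fin N → ℝ≥0∞} (hp : ∀ i, p i ≠ 0) {k : ℕ} (I : Fin k → Fin N) :
    combinedWeight τ p k (wordComp τ I) ≠ 0 := by
  intro h
  have := Finset.sum_eq_zero_iff.1 h I (Finset.mem_univ _)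
  rw [if_pos rfl, Finset.prod_eq_zero_iff] at this
  obtain ⟨j, -, hj⟩ := this
  exact hp _ hj

/-- For an affine IFS `τ_i(x) = R⁻¹(x + b_i)` with `‖R⁻¹x‖ ≤ r‖x‖`,
`0 < r < 1`, attractor `X` and invariant probability measure `μ`: if the fixed point
condition holds for `σ = τ_I` at level `k`, then there are `n₀` and a constant `C`
(independent of `n`) with `μ(σ^n(X)) = C · p_σ^n` for all `n ≥ n₀`. -/
theorem statement11 {d N : ℕ} (hN : 0 < N)
    (R : Matrix (Fin d) (Fin d) ℝ) (hR : IsUnit R.det)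
    (r : ℝ) (hr0 : 0 < r) (hr1 : r < 1)
    (hcontr : ∀ x : EuclideanSpace ℝ (Fin d), ‖Matrix.toEuclideanLin R⁻¹ x‖ ≤ r * ‖x‖)
    (b : Fin N → EuclideanSpace ℝ (Fin d))
    (τ : Fin N → EuclideanSpace ℝ (Fin d) → EuclideanSpace ℝ (Fin d))
    (hτ : ∀ i x, τ i x = Matrix.toEuclideanLin R⁻¹ (x + b i))
    (X : Set (EuclideanSpace ℝ (Fin d))) (hXne : X.Nonempty) (hXcomp : IsCompact X)
    (hX : X = ⋃ i, τ i '' X)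
    (p : Fin N → ℝ≥0∞) (hp : ∀ i, 0 < p i) (hpsum : ∑ i, p i = 1)
    (μ : Measure (EuclideanSpace ℝ (Fin d))) [IsProbabilityMeasure μ]
    (hμX : μ Xᶜ = 0)
    (hinv : ∀ E : Set (EuclideanSpace ℝ (Fin d)), MeasurableSet E →
      μ E = ∑ i, p i * μ (τ i ⁻¹' E))
    (k : ℕ) (hk : 0 < k) (I : Fin k → Fin N)
    (σ : EuclideanSpace ℝ (Fin d) → EuclideanSpace ℝ (Fin d)) (hσ : σ = wordComp τ I)
    (xσ : EuclideanSpace ℝ (Fin d)) (hfix : σ xσ = xσ)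
    (hfpc : ∀ J : Fin k → Fin N, wordComp τ J ≠ σ → xσ ∉ (wordComp τ J) '' X) :
    ∃ (n₀ : ℕ) (C : ℝ≥0∞), ∀ n ≥ n₀, μ (σ^[n] '' X) = C * (combinedWeight τ p k σ) ^ n := by
  have hinj : ∀ i, Function.Injective (τ i) := by
    intro i x y hxy
    have hdet : IsUnit R⁻¹.det := Matrix.isUnit_nonsing_inv_det R hR
    rw [hτ, hτ] at hxy
    have h := Matrix.mulVec_injective_of_isUnit ((Matrix.isUnit_iff_isUnit_det _).2 hdet)
      (congrArg WithLp.ofLp hxy)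
    exact add_right_cancel (WithLp.ofLp_injective 2 h)
  lift r to NNReal using hr0.le
  have hlip : ∀ i, LipschitzWith r (τ i) := by
    refine fun i => LipschitzWith.of_dist_le_mul fun x y => ?_
    rw [hτ, hτ, dist_eq_norm, ← map_sub, dist_eq_norm]
    simpa using hcontr (x + b i - (y + b i))
  have hσlip : LipschitzWith (r ^ k) σ := hσ ▸ wordComp_lipschitzWith hlip I
  have hσinj : Function.Injective σ := hσ ▸ wordComp_injective hinj I
  have hr' : r ^ k < 1 := pow_lt_one₀ zero_le (by exact_mod_cast hr1) hk.ne'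
  have hdisj : ∀ᶠ n in Filter.atTop, ∀ J : Fin k → Fin N, wordComp τ J ≠ σ →
      Disjoint (σ^[n] '' X) (wordComp τ J '' X) := by
    refine Filter.eventually_all.2 fun J => ?_
    by_cases hJ : wordComp τ J = σ
    · simp [hJ]
    · have hcl := (hXcomp.image (wordComp_lipschitzWith hlip J).continuous).isClosed
      filter_upwards [eventually_disjoint_iterate_image hr' hσlip hfix hXcomp.isBounded hcl
        (hfpc J hJ)] with n hn _ using hn
  obtain ⟨n₀, hn₀⟩ := Filter.eventually_atTop.1 hdisj
  have hstep : ∀ n ≥ n₀,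
      μ (σ^[n + 1] '' X) = μ (σ^[n] '' X) * combinedWeight τ p k σ := by
    intro n hn
    have hmeas : MeasurableSet (σ^[n + 1] '' X) :=
      (hXcomp.image (hσlip.continuous.iterate _)).measurableSet
    rw [measure_eq_sum_wordComp (fun i => (hlip i).continuous.measurable) hinv k hmeas,
      combinedWeight, Finset.mul_sum]
    refine Finset.sum_congr rfl fun J _ => ?_
    by_cases hJ : wordComp τ J = σ
    · rw [if_pos hJ, hJ, Function.iterate_succ', Set.image_comp,
        Set.preimage_image_eq _ hσinj, mul_comm]
    · have hzero : μ (wordComp τ J ⁻¹' (σ^[n + 1] '' X)) = 0 := by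
        refine measure_mono_null (t := Xᶜ) (fun x hx hxX => ?_) hμX
        exact Set.disjoint_left.1 (hn₀ (n + 1) (by omega) J hJ) hx (Set.mem_image_of_mem _ hxX)
      rw [if_neg hJ, hzero, mul_zero, mul_zero]
  have hptop : ∀ i, p i ≠ ∞ := fun i =>
    ENNReal.sum_ne_top.1 (hpsum ▸ ENNReal.one_ne_top) i (Finset.mem_univ i)
  have htop := combinedWeight_ne_top τ hptop k σ
  have hne : combinedWeight τ p k σ ≠ 0 :=
    hσ ▸ combinedWeight_wordComp_ne_zero τ (fun i => (hp i).ne') I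
  refine ⟨n₀, μ (σ^[n₀] '' X) / combinedWeight τ p k σ ^ n₀, fun n hn => ?_⟩
  induction n, hn using Nat.le_induction with
  | base => exact (ENNReal.div_mul_cancel (pow_ne_zero _ hne) (ENNReal.pow_ne_top htop)).symm
  | succ n hn ih => rw [hstep n hn, ih, pow_succ, mul_assoc]
end

section
/- Let D ⊆ ℤ be a finite set with #D = N ≥ 2, let τ_d(x) = (x + d)/N for d ∈ D, and let X be the attractor of this iterated function system (the unique nonempty compact set with X = ⋃_{d∈D} τ_d(X)). If X has positive Lebesgue measure (i.e., X is a self-similar tile on ℝ), then D tiles the integers: there exists E ⊆ ℤ such that every integer n has a unique representation n = d + e with d ∈ D and e ∈ E. -/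
open MeasureTheory

/-- A finite family of measurable sets whose union has at least the sum of their measures
(and finite measure) is pairwise almost everywhere disjoint. -/
theorem aedisjoint_of_sum_measure_le {α ι : Type*} [MeasurableSpace α] {μ : Measure α}
    (s : Finset ι) (A : ι → Set α) (hA : ∀ i ∈ s, MeasurableSet (A i))
    (hfin : μ (⋃ i ∈ s, A i) ≠ ⊤) (hle : ∑ i ∈ s, μ (A i) ≤ μ (⋃ i ∈ s, A i))
    {i j : ι} (hi : i ∈ s) (hj : j ∈ s) (hij : i ≠ j) : μ (A i ∩ A j) = 0 := by
  classical
  set B : Set α := ⋃ e ∈ s.erase i, A e with hB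
  have hunion : A i ∪ B = ⋃ i ∈ s, A i := by
    rw [hB, ← Finset.set_biUnion_insert, Finset.insert_erase hi]
  have hBm : MeasurableSet B :=
    Finset.measurableSet_biUnion _ fun e he => hA e (Finset.mem_of_mem_erase he)
  have hsum : μ (A i) + μ B ≤ ∑ i ∈ s, μ (A i) := by
    rw [← Finset.add_sum_erase s _ hi]
    gcongr
    exact measure_biUnion_finset_le _ _
  have hadd := measure_union_add_inter (μ := μ) (A i) hBm
  rw [hunion] at hadd
  have hzero : μ (A i ∩ B) = 0 := by
    have h : μ (⋃ i ∈ s, A i) + μ (A i ∩ B) ≤ μ (⋃ i ∈ s, A i) + 0 := by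
      rw [hadd, add_zero]
      exact hsum.trans hle
    exact le_antisymm ((ENNReal.add_le_add_iff_left hfin).1 h) zero_le
  refine measure_mono_null (Set.inter_subset_inter_right _ ?_) hzero
  exact Set.subset_biUnion_of_mem (u := A) (Finset.mem_erase.2 ⟨hij.symm, hj⟩)

theorem volume_preimage_mul_sub (a b : ℝ) (ha : 0 < a) (Y : Set ℝ) :
    volume {x : ℝ | a * x - b ∈ Y} = ENNReal.ofReal a⁻¹ * volume Y := by
  have h : {x : ℝ | a * x - b ∈ Y} = (a * ·) ⁻¹' ((fun x => x + -b) ⁻¹' Y) := by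
    ext x
    simp [sub_eq_add_neg]
  rw [h, Real.volume_preimage_mul_left ha.ne', measure_preimage_add_right,
    abs_of_pos (inv_pos.2 ha)]

/-- A self-similar set is, at each scale, a union of `#D` small translates of one set whose
measure is at most `1 / #D` of the whole. -/
theorem exists_translates_of_selfSimilar (D : Finset ℤ) (hD : 0 < D.card) (X : Set ℝ)
    (hXm : MeasurableSet X)
    (hX : ∀ x, x ∈ X ↔ ∃ d ∈ D, (D.card : ℝ) * x - d ∈ X) (k : ℕ) :
    ∃ Y : Set ℝ, MeasurableSet Y ∧
      (∀ x, x ∈ X ↔ ∃ d ∈ D, x - ((D.card : ℝ) ^ (k + 1))⁻¹ * d ∈ Y) ∧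
      volume Y ≤ ENNReal.ofReal (D.card : ℝ)⁻¹ * volume X := by
  have hN : (0 : ℝ) < D.card := by exact_mod_cast hD
  induction k with
  | zero =>
    refine ⟨{x | (D.card : ℝ) * x - 0 ∈ X}, ?_, fun x => ?_,
      (volume_preimage_mul_sub _ _ hN _).le⟩
    · exact hXm.preimage (by fun_prop)
    · rw [hX x]
      refine exists_congr fun d => and_congr_right fun _ => ?_
      rw [Set.mem_ofPred_eq]
      have : (D.card : ℝ) * (x - ((D.card : ℝ) ^ (0 + 1))⁻¹ * d) - 0 = D.card * x - d := by
        field_simp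
        ring
      rw [this]
  | succ k ih =>
    obtain ⟨Y, hYm, hY, hYv⟩ := ih
    have hset : {x : ℝ | ∃ d ∈ D, (D.card : ℝ) * x - d ∈ Y} =
        ⋃ d ∈ D, {x : ℝ | (D.card : ℝ) * x - d ∈ Y} := by
      ext x
      simp
    refine ⟨{x | ∃ d ∈ D, (D.card : ℝ) * x - d ∈ Y}, ?_, fun x => ?_, ?_⟩
    · rw [hset]
      exact Finset.measurableSet_biUnion _ fun d _ => hYm.preimage (by fun_prop)
    · have key (d e : ℤ) : (D.card : ℝ) * x - d - ((D.card : ℝ) ^ (k + 1))⁻¹ * e =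
          D.card * (x - ((D.card : ℝ) ^ (k + 1 + 1))⁻¹ * e) - d := by
        clear hX hY
        field_simp
        ring
      simp only [hX x, hY, key, Set.mem_ofPred_eq]
      constructor
      · rintro ⟨d, hd, e, he, h⟩
        exact ⟨e, he, d, hd, h⟩
      · rintro ⟨e, he, d, hd, h⟩
        exact ⟨d, hd, e, he, h⟩
    · rw [hset]
      refine (measure_biUnion_finset_le _ _).trans ?_
      simp only [volume_preimage_mul_sub _ _ hN, Finset.sum_const, nsmul_eq_mul]
      rw [← mul_assoc]
      have : ((D.card : ℕ) : ENNReal) * ENNReal.ofReal (D.card : ℝ)⁻¹ = 1 := by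
        rw [ENNReal.ofReal_inv_of_pos hN, ENNReal.ofReal_natCast]
        exact ENNReal.mul_inv_cancel (by exact_mod_cast hD.ne') (ENNReal.natCast_ne_top _)
      rw [this, one_mul]
      exact hYv

/-- At a density point of `X`, every sufficiently fine arithmetic progression of bounded length
can be moved into `X`, avoiding any given null sets. -/
theorem exists_progression_subset (X : Set ℝ) (hXm : MeasurableSet X) (hXpos : 0 < volume X)
    (c : ℕ → ℝ) (hc : ∀ k, 0 < c k) (hc0 : Filter.Tendsto c Filter.atTop (nhds 0))
    (Z : ℕ → Set ℝ) (hZ : ∀ k, volume (Z k) = 0) (L : ℕ) :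
    ∃ k t, ∀ n : ℤ, |n| ≤ L → t + c k * n ∈ X ∧ t + c k * n ∉ Z k := by
  obtain ⟨p, hpX, hp⟩ : ∃ p ∈ X, Filter.Tendsto
      (fun r => volume (Xᶜ ∩ Metric.closedBall p r) / volume (Metric.closedBall p r))
      (nhdsWithin 0 (Set.Ioi 0)) (nhds 0) := by
    have hae := Besicovitch.ae_tendsto_measure_inter_div_of_measurableSet
      (volume : Measure ℝ) hXm.compl
    by_contra! hcon
    refine hXpos.ne' (measure_mono_null (fun x hx => ?_) hae)
    intro h
    rw [Set.mem_ofPred_eq, Set.indicator_of_notMem (Set.notMem_compl_iff.2 hx)] at h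
    exact hcon x hx h
  set M : ℝ := (L : ℝ) + 1 with hM
  have hMpos : 0 < M := by positivity
  have hr : Filter.Tendsto (fun k => c k * M) Filter.atTop (nhdsWithin 0 (Set.Ioi 0)) := by
    refine tendsto_nhdsWithin_iff.2 ⟨by simpa using hc0.mul_const M, ?_⟩
    exact Filter.Eventually.of_forall fun k => mul_pos (hc k) hMpos
  have hε : (0 : ENNReal) < ENNReal.ofReal (1 / (4 * M ^ 2)) :=
    ENNReal.ofReal_pos.2 (by positivity)
  obtain ⟨k, hk⟩ := ((hp.comp hr).eventually (gt_mem_nhds hε)).exists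
  have hck := hc k
  simp only [Function.comp_apply, Real.volume_closedBall] at hk
  rw [ENNReal.div_lt_iff (Or.inl (ENNReal.ofReal_pos.2 (by positivity)).ne')
    (Or.inl ENNReal.ofReal_ne_top), ← ENNReal.ofReal_mul (by positivity)] at hk
  have hval : 1 / (4 * M ^ 2) * (2 * (c k * M)) = c k / (2 * M) := by
    field_simp
    ring
  rw [hval] at hk
  set W : Set ℝ := (Xᶜ ∩ Metric.closedBall p (c k * M)) ∪ Z k with hW
  have hWv : volume W ≤ ENNReal.ofReal (c k / (2 * M)) := by
    refine (measure_union_le _ _).trans ?_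
    rw [hZ k, add_zero]
    exact hk.le
  set Bad : Set ℝ := ⋃ n ∈ Finset.Icc (-(L : ℤ)) L, (fun t : ℝ => t + c k * n) ⁻¹' W with hBad
  have hBadv : volume Bad < ENNReal.ofReal (c k) := by
    calc volume Bad ≤ ∑ n ∈ Finset.Icc (-(L : ℤ)) L,
          volume ((fun t : ℝ => t + c k * n) ⁻¹' W) := measure_biUnion_finset_le _ _
      _ = ∑ n ∈ Finset.Icc (-(L : ℤ)) L, volume W := by simp only [measure_preimage_add_right]
      _ ≤ ∑ n ∈ Finset.Icc (-(L : ℤ)) L, ENNReal.ofReal (c k / (2 * M)) :=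
          Finset.sum_le_sum fun _ _ => hWv
      _ = ENNReal.ofReal ((2 * L + 1 : ℕ) * (c k / (2 * M))) := by
          rw [Finset.sum_const, nsmul_eq_mul, ENNReal.ofReal_mul (by positivity),
            ENNReal.ofReal_natCast, Int.card_Icc]
          congr 2
          omega
      _ < ENNReal.ofReal (c k) := by
          rw [ENNReal.ofReal_lt_ofReal_iff hck]
          rw [mul_div_assoc', div_lt_iff₀ (by positivity), mul_comm]
          gcongr
          rw [hM]
          push_cast
          linarith
  obtain ⟨t, htB, htBad⟩ : ∃ t ∈ Metric.closedBall p (c k / 2), t ∉ Bad := by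
    by_contra! hcon
    have h := measure_mono (μ := volume) hcon
    rw [Real.volume_closedBall, mul_div_cancel₀ _ (two_ne_zero)] at h
    exact absurd hBadv (not_lt.2 h)
  refine ⟨k, t, fun n hn => ?_⟩
  have hnW : t + c k * n ∉ W := fun h => htBad <| by
    rw [hBad]
    exact Set.mem_biUnion (show n ∈ Finset.Icc (-(L : ℤ)) L from
      Finset.mem_Icc.2 (abs_le.1 hn)) h
  refine ⟨?_, fun h => hnW (Or.inr h)⟩
  by_contra hnX
  refine hnW (Or.inl ⟨hnX, ?_⟩)
  rw [Metric.mem_closedBall, Real.dist_eq] at htB ⊢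
  have hn' : |(n : ℝ)| ≤ L := by exact_mod_cast hn
  calc |t + c k * n - p| = |(t - p) + c k * n| := by ring_nf
    _ ≤ |t - p| + |c k * n| := abs_add_le _ _
    _ ≤ c k / 2 + c k * L := by
        rw [abs_mul, abs_of_pos hck]
        gcongr
    _ ≤ c k * M := by
        rw [hM]
        linarith

/-- A finite set of integers that tiles arbitrarily long intervals tiles `ℤ`. -/
theorem exists_tiling_of_forall_interval (D : Finset ℤ)
    (h : ∀ L : ℕ, ∃ A : Set ℤ, ∀ n : ℤ, |n| ≤ L → ∃! d, d ∈ D ∧ n - d ∈ A) :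
    ∃ E : Set ℤ, ∀ n : ℤ, ∃! d, d ∈ D ∧ n - d ∈ E := by
  choose A hA using h
  let F : Ultrafilter ℕ := Filter.hyperfilter ℕ
  have hF : (F : Filter ℕ) ≤ Filter.atTop := Nat.hyperfilter_le_atTop
  refine ⟨{n | ∀ᶠ L in F, n ∈ A L}, fun n => ?_⟩
  have hn : ∀ᶠ L in F, ∃! d, d ∈ D ∧ n - d ∈ A L := by
    refine hF ((Filter.eventually_ge_atTop n.natAbs).mono fun L hL => hA L n ?_)
    rw [Int.abs_eq_natAbs]
    exact_mod_cast hL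
  obtain ⟨d, hd, hdA⟩ : ∃ d ∈ D, ∀ᶠ L in F, n - d ∈ A L := by
    by_contra! hcon
    have h₁ : ∀ᶠ L in F, ∀ d ∈ D, n - d ∉ A L :=
      (Filter.eventually_all_finset D).2 hcon
    obtain ⟨L, hL, d, hd, -⟩ := (h₁.and hn).exists
    exact hL d hd.1 hd.2
  refine ⟨d, ⟨hd, hdA⟩, fun e he => ?_⟩
  obtain ⟨L, ⟨hL₁, hL₂⟩, hL₃⟩ := ((hdA.and he.2).and hn).exists
  exact hL₃.unique ⟨he.1, hL₂⟩ ⟨hd, hL₁⟩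

/-- Let `D ⊆ ℤ` be finite with `#D = N ≥ 2`, let `τ_d(x) = (x + d)/N`, and
let `X` be the attractor of this IFS. If `X` has positive Lebesgue measure (it is a
self-similar tile on `ℝ`), then `D` tiles the integers: there is `E ⊆ ℤ` so that every
integer is uniquely `d + e` with `d ∈ D`, `e ∈ E`. -/
theorem statement16 (D : Finset ℤ) (hD : 2 ≤ D.card)
    (X : Set ℝ) (hXne : X.Nonempty) (hXcomp : IsCompact X)
    (hX : X = ⋃ d ∈ D, (fun x : ℝ => (x + (d : ℝ)) / (D.card : ℝ)) '' X)
    (hXpos : 0 < volume X) :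
    ∃ E : Set ℤ, ∀ n : ℤ, ∃! q : ℤ × ℤ, q.1 ∈ D ∧ q.2 ∈ E ∧ n = q.1 + q.2 := by
  have hN : (1 : ℝ) < D.card := by exact_mod_cast hD
  have hN0 : (0 : ℝ) < D.card := zero_lt_one.trans hN
  have hXm : MeasurableSet X := hXcomp.measurableSet
  have hmem : ∀ x, x ∈ X ↔ ∃ d ∈ D, (D.card : ℝ) * x - d ∈ X := by
    intro x
    conv_lhs => rw [hX]
    simp only [Set.mem_iUnion, Set.mem_image, exists_prop]
    refine exists_congr fun d => and_congr_right fun _ => ?_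
    constructor
    · rintro ⟨y, hy, rfl⟩
      rwa [mul_div_cancel₀ _ hN0.ne', add_sub_cancel_right]
    · intro h
      exact ⟨_, h, by rw [sub_add_cancel, mul_div_cancel_left₀ _ hN0.ne']⟩
  clear hX
  choose Y hYm hY hYv using exists_translates_of_selfSimilar D (by omega) X hXm hmem
  set c : ℕ → ℝ := fun k => ((D.card : ℝ) ^ (k + 1))⁻¹ with hcdef
  have hc : ∀ k, 0 < c k := fun k => inv_pos.2 (pow_pos hN0 _)
  have hc0 : Filter.Tendsto c Filter.atTop (nhds 0) :=
    ((tendsto_pow_atTop_atTop_of_one_lt hN).comp (Filter.tendsto_add_atTop_nat 1)).inv_tendsto_atTop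
  let A : ℕ → ℤ → Set ℝ := fun k d => (fun x => x + -(c k * d)) ⁻¹' Y k
  have hAX (k : ℕ) : X = ⋃ d ∈ D, A k d := by
    ext x
    simp [A, hY k x, hcdef, sub_eq_add_neg]
  have hdisj (k : ℕ) {d e : ℤ} (hd : d ∈ D) (he : e ∈ D) (hde : d ≠ e) :
      volume (A k d ∩ A k e) = 0 := by
    refine aedisjoint_of_sum_measure_le D (A k)
      (fun d _ => (hYm k).preimage (by fun_prop)) ?_ ?_ hd he hde
    · rw [← hAX]
      exact hXcomp.measure_lt_top.ne
    · rw [← hAX]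
      simp only [A, measure_preimage_add_right, Finset.sum_const, nsmul_eq_mul]
      calc ((D.card : ℕ) : ENNReal) * volume (Y k)
          ≤ D.card * (ENNReal.ofReal (D.card : ℝ)⁻¹ * volume X) := by
            gcongr
            exact hYv k
        _ = volume X := by
            rw [← mul_assoc, ENNReal.ofReal_inv_of_pos hN0, ENNReal.ofReal_natCast,
              ENNReal.mul_inv_cancel (by exact_mod_cast hN0.ne') (ENNReal.natCast_ne_top _),
              one_mul]
  let Z : ℕ → Set ℝ := fun k => ⋃ q ∈ D.offDiag, A k q.1 ∩ A k q.2
  have hZ (k : ℕ) : volume (Z k) = 0 := by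
    refine (measure_biUnion_null_iff (Finset.countable_toSet _)).2 fun q hq => ?_
    obtain ⟨h₁, h₂, h₃⟩ := Finset.mem_offDiag.1 hq
    exact hdisj k h₁ h₂ h₃
  obtain ⟨E, hE⟩ := exists_tiling_of_forall_interval D fun L => by
    obtain ⟨k, t, ht⟩ := exists_progression_subset X hXm hXpos c hc hc0 Z hZ L
    refine ⟨{m | t + c k * m ∈ Y k}, fun n hn => ?_⟩
    obtain ⟨hnX, hnZ⟩ := ht n hn
    have hiff (d : ℤ) : n - d ∈ {m : ℤ | t + c k * m ∈ Y k} ↔ t + c k * n ∈ A k d := by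
      simp only [Set.mem_ofPred_eq, A, Set.mem_preimage]
      push_cast
      ring_nf
    simp only [hiff]
    rw [hAX k] at hnX
    obtain ⟨d, hd, hdA⟩ := Set.mem_iUnion₂.1 hnX
    refine ⟨d, ⟨hd, hdA⟩, fun e he => ?_⟩
    by_contra hne
    exact hnZ (Set.mem_biUnion (show (e, d) ∈ (D.offDiag : Set (ℤ × ℤ)) from
      Finset.mem_coe.2 (Finset.mem_offDiag.2 ⟨he.1, hd, hne⟩)) ⟨he.2, hdA⟩)
  refine ⟨E, fun n => ?_⟩
  obtain ⟨d, ⟨hd, hdE⟩, huniq⟩ := hE n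
  refine ⟨(d, n - d), ⟨hd, hdE, by simp⟩, ?_⟩
  rintro ⟨a, b⟩ ⟨ha, hb, hab⟩
  simp only at ha hb hab
  obtain rfl : a = d := huniq a ⟨ha, by rwa [hab, add_sub_cancel_left]⟩
  rw [hab, add_sub_cancel_left]
end

section
/- Let μ be a finite Borel measure on ℝ whose support is exactly the interval [0,1], and suppose μ is singular with respect to Lebesgue measure. Then there exist a Borel set F ⊆ [0,1] and a real number a with F + a ⊆ [0,1] such that the measure E ↦ μ((E + a) ∩ (F + a)) is NOT absolutely continuous with respect to μ; in fact there exists a Borel set E with μ(E) = 0 but μ((E + a) ∩ (F + a)) > 0. -/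
open MeasureTheory

/-- A Lebesgue-null set is null, for an s-finite measure on `ℝ`, after almost every translation. -/
theorem ae_measure_preimage_add_eq_zero (μ : Measure ℝ) [SFinite μ] {s : Set ℝ}
    (hs : MeasurableSet s) (hs0 : volume s = 0) :
    ∀ᵐ a : ℝ, μ ((fun x => x + a) ⁻¹' s) = 0 := by
  have hmeas : MeasurableSet {p : ℝ × ℝ | p.1 + p.2 ∉ s} :=
    (measurable_fst.add measurable_snd) hs.compl
  have h : ∀ᵐ x ∂μ, ∀ᵐ a : ℝ, x + a ∉ s := by
    refine Filter.Eventually.of_forall fun x => ?_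
    have hx : volume ((fun a => x + a) ⁻¹' s) = 0 := by rwa [measure_preimage_add]
    exact measure_eq_zero_iff_ae_notMem.mp hx
  filter_upwards [(Measure.ae_ae_comm hmeas).mp h] with a ha
  exact measure_eq_zero_iff_ae_notMem.mpr ha

/-- Let `μ` be a finite Borel measure on `ℝ` whose support is exactly
`[0,1]` (every ball around a point of `[0,1]` has positive measure, and the complement of
`[0,1]` is null), and suppose `μ` is singular with respect to Lebesgue measure. Then there
are a Borel set `F ⊆ [0,1]` and `a ∈ ℝ` with `F + a ⊆ [0,1]` such that the measure
`E ↦ μ((E + a) ∩ (F + a))` is not absolutely continuous with respect to `μ`: indeed some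
Borel set `E` has `μ(E) = 0` but `μ((E + a) ∩ (F + a)) > 0`.
Here `E + a = {x : x - a ∈ E}`. -/
theorem statement17 (μ : Measure ℝ) [IsFiniteMeasure μ]
    (hsupp_pos : ∀ x ∈ Set.Icc (0 : ℝ) 1, ∀ ε > (0 : ℝ), 0 < μ (Metric.ball x ε))
    (hsupp_full : μ (Set.Icc (0 : ℝ) 1)ᶜ = 0)
    (hsing : μ.MutuallySingular volume) :
    ∃ (F : Set ℝ) (a : ℝ), MeasurableSet F ∧ F ⊆ Set.Icc (0 : ℝ) 1 ∧
      (∀ x ∈ F, x + a ∈ Set.Icc (0 : ℝ) 1) ∧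
      ¬ (Measure.map (fun x => x - a) (μ.restrict ((fun x => x - a) ⁻¹' F)) ≪ μ) ∧
      ∃ E : Set ℝ, MeasurableSet E ∧ μ E = 0 ∧
        0 < μ ((fun x => x - a) ⁻¹' E ∩ (fun x => x - a) ⁻¹' F) := by
  obtain ⟨t, ht, hμt, hvol⟩ := hsing
  obtain ⟨a, ⟨ha0, ha1⟩, ha⟩ : ∃ a ∈ Set.Ioo (0 : ℝ) (1 / 2),
      μ ((fun x => x + a) ⁻¹' tᶜ) = 0 := by
    by_contra! hne
    have hnull : volume (Set.Ioo (0 : ℝ) (1 / 2)) = 0 :=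
      measure_mono_null hne (ae_measure_preimage_add_eq_zero μ ht.compl hvol)
    norm_num at hnull
  set F : Set ℝ := (fun x => x + a) ⁻¹' tᶜ ∩ Set.Icc 0 (1 - a)
  have hFm : MeasurableSet F :=
    ((measurable_id.add_const a) ht.compl).inter measurableSet_Icc
  have hF0 : μ F = 0 := measure_mono_null Set.inter_subset_left ha
  have hpos : 0 < μ ((fun x => x - a) ⁻¹' F) := by
    refine (hsupp_pos (3 / 4) (by norm_num) (1 / 4) (by norm_num)).trans_le ?_
    rw [← measure_sdiff_null hμt]
    refine measure_mono fun x hx => ?_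
    obtain ⟨hxb, hxt⟩ := hx
    rw [Real.ball_eq_Ioo] at hxb
    refine ⟨by simpa using hxt, ?_, ?_⟩ <;> linarith [hxb.1, hxb.2]
  have hsub : Measurable fun x : ℝ => x - a := measurable_id.sub_const a
  refine ⟨F, a, hFm, ?_, ?_, ?_, F, hFm, hF0, by rwa [Set.inter_self]⟩
  · rintro x ⟨-, hx0, hx1⟩
    exact ⟨hx0, by linarith⟩
  · rintro x ⟨-, hx0, hx1⟩
    constructor <;> linarith
  · intro hac
    have h := hac hF0
    rw [Measure.map_apply hsub hFm, Measure.restrict_apply (hsub hFm), Set.inter_self] at h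
    exact hpos.ne' h
end
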